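/- Every finite subgroup G of SO(3,ℝ), the group of real orthogonal 3×3 matrices of determinant 1, is either cyclic, or isomorphic to a dihedral group D_n for some n ≥ 1, or isomorphic to A₄, S₄, or A₅. -/

import Mathlib

open Matrix

theorem nonempty_mulEquiv_dihedralGroup {G : Type*} [Group G] [Finite G] (C : Subgroup G)
    [IsCyclic C] (hC : C.index = 2) (hinv : ∀ g ∉ C, g * g = 1) :
    Nonempty (G ≃* DihedralGroup (Nat.card C)) := by
  obtain ⟨s, hs⟩ : ∃ s, s ∉ C := by
    by_contra! h
    rw [(Subgroup.eq_top_iff' C).2 h, Subgroup.index_top] at hC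
    omega
  let φ : Multiplicative (ZMod (Nat.card C)) ≃* C := zmodCyclicMulEquiv (inferInstance : IsCyclic C)
  have hss : s * s = 1 := hinv s hs
  have hcs (c : G) (hc : c ∈ C) : c * s = s * c⁻¹ := by
    have h : s * c * (s * c) = 1 := hinv _ fun h ↦ hs ((C.mul_mem_cancel_right hc).1 h)
    calc c * s = s⁻¹ * (s * c * (s * c)) * c⁻¹ := by group
      _ = s⁻¹ * c⁻¹ := by rw [h, mul_one]
      _ = s * c⁻¹ := by rw [inv_eq_of_mul_eq_one_left hss]
  have hφs (i : ZMod (Nat.card C)) :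
      (φ (.ofAdd i) : G) * s = s * (φ (.ofAdd (-i)) : G) := by
    rw [hcs _ (φ _).2, ofAdd_neg, map_inv, InvMemClass.coe_inv]
  have hφadd (i j : ZMod (Nat.card C)) :
      (φ (.ofAdd (i + j)) : G) = φ (.ofAdd i) * φ (.ofAdd j) := by
    rw [ofAdd_add, map_mul, Subgroup.coe_mul]
  let f : DihedralGroup (Nat.card C) →* G := MonoidHom.mk'
    (fun | .r i => φ (.ofAdd i) | .sr i => s * φ (.ofAdd i)) <| by
      rintro (i | i) (j | j)
      · exact hφadd i j
      · change s * (φ (.ofAdd (j - i)) : G) = φ (.ofAdd i) * (s * φ (.ofAdd j))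
        rw [sub_eq_neg_add, hφadd, ← mul_assoc, ← mul_assoc, hφs]
      · change s * (φ (.ofAdd (i + j)) : G) = s * φ (.ofAdd i) * φ (.ofAdd j)
        rw [hφadd, mul_assoc]
      · change (φ (.ofAdd (j - i)) : G) = s * φ (.ofAdd i) * (s * φ (.ofAdd j))
        rw [sub_eq_neg_add, hφadd, ← mul_assoc, mul_assoc s, hφs, ← mul_assoc s s, hss, one_mul]
  have hf : Function.Injective f := by
    rw [injective_iff_map_eq_one]
    rintro (i | i) h
    · have h : (φ (.ofAdd i) : G) = 1 := h
      have : Multiplicative.ofAdd i = 1 := φ.injective (by rw [map_one]; exact Subtype.ext h)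
      exact congrArg DihedralGroup.r this
    · have h : s * (φ (.ofAdd i) : G) = 1 := h
      exact absurd (eq_inv_of_mul_eq_one_left h ▸ C.inv_mem (φ _).2) hs
  have hcard : Nat.card (DihedralGroup (Nat.card C)) = Nat.card G := by
    rw [DihedralGroup.nat_card, ← C.index_mul_card, hC]
  have : NeZero (Nat.card C) := ⟨Nat.card_pos.ne'⟩
  exact ⟨(MulEquiv.ofBijective f ((Nat.bijective_iff_injective_and_card f).2 ⟨hf, hcard⟩)).symm⟩

theorem exists_injective_hom_perm_of_normalCore_eq_bot {G : Type*} [Group G] (H : Subgroup G)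
    [H.FiniteIndex] (hH : H.normalCore = ⊥) :
    ∃ f : G →* Equiv.Perm (Fin H.index), Function.Injective f := by
  let e : G ⧸ H ≃ Fin H.index := Finite.equivFin (G ⧸ H)
  refine ⟨(e.permCongrHom.toMonoidHom).comp (MulAction.toPermHom G (G ⧸ H)), ?_⟩
  refine e.permCongrHom.injective.comp ?_
  rw [← MonoidHom.ker_eq_bot_iff, ← Subgroup.normalCore_eq_ker, hH]

theorem nonempty_mulEquiv_perm {G : Type*} [Group G] [Finite G] {n : ℕ}
    (f : G →* Equiv.Perm (Fin n)) (hf : Function.Injective f) (hG : Nat.card G = n.factorial) :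
    Nonempty (G ≃* Equiv.Perm (Fin n)) :=
  ⟨MulEquiv.ofBijective f ((Nat.bijective_iff_injective_and_card f).2
    ⟨hf, by rw [hG, Nat.card_perm, Nat.card_fin]⟩)⟩

theorem nonempty_mulEquiv_alternatingGroup {G : Type*} [Group G] [Finite G] {n : ℕ}
    (f : G →* Equiv.Perm (Fin n)) (hf : Function.Injective f)
    (hG : 2 * Nat.card G = n.factorial) :
    Nonempty (G ≃* alternatingGroup (Fin n)) := by
  have hcard : Nat.card f.range = Nat.card G := (Nat.card_congr (f.ofInjective hf).toEquiv).symm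
  have hindex : f.range.index = 2 := by
    have h := f.range.index_mul_card
    rw [hcard, Nat.card_perm, Nat.card_fin, ← hG] at h
    exact Nat.eq_of_mul_eq_mul_right Nat.card_pos h
  rw [← Equiv.Perm.eq_alternatingGroup_of_index_eq_two hindex]
  exact ⟨f.ofInjective hf⟩

theorem exists_injective_hom_perm_four {G : Type*} [Group G] [Finite G]
    (hG : Nat.card G = 12 ∨ Nat.card G = 24)
    (hN : ∀ K : Subgroup G, K.Normal → Nat.card K ∣ 6 → K = ⊥) :
    ∃ f : G →* Equiv.Perm (Fin 4), Function.Injective f := by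
  have : Fact (Nat.Prime 3) := ⟨Nat.prime_three⟩
  let P : Sylow 3 G := default
  have hP : Nat.card P = 3 := by
    obtain ⟨k, hk⟩ := P.2.exists_card_eq
    have h1 : Nat.card P ∣ Nat.card G := P.card_subgroup_dvd_card
    have h3 : 3 ∣ Nat.card P := P.dvd_card_of_dvd_card (by omega)
    have h4 : Nat.card P ∣ 24 := h1.trans (by rcases hG with h | h <;> simp [h])
    change Nat.card P = 3 ^ k at hk
    match k with
    | 0 => simp [hk] at h3
    | 1 => simpa using hk
    | k + 2 =>
      have : 9 ∣ 24 := (Dvd.intro_left (3 ^ k) (by rw [hk, pow_add]; rfl) : 9 ∣ Nat.card P).trans h4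
      omega
  set H := Subgroup.normalizer (P : Set G)
  have hmod : H.index ≡ 1 [MOD 3] := by
    rw [← P.card_eq_index_normalizer]; exact card_sylow_modEq_one 3 G
  have hmul := H.index_mul_card
  have h3 : 3 ∣ Nat.card H := hP ▸ Subgroup.card_dvd_of_le Subgroup.le_normalizer
  obtain ⟨m, hm⟩ := h3
  have hdvd : H.index ∣ 8 := by
    rcases hG with h | h
    · exact ⟨2 * m, by rw [h, hm] at hmul; linarith⟩
    · exact ⟨m, by rw [h, hm] at hmul; linarith⟩
  have hle := Nat.le_of_dvd (by norm_num) hdvd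
  have h4 : H.index = 4 := by
    have hne : H.index ≠ 1 := fun h1 ↦ by
      have hn : (P : Subgroup G).Normal :=
        Subgroup.normalizer_eq_top_iff.1 (Subgroup.index_eq_one.1 h1)
      have := hN P hn (by rw [hP]; decide)
      have h1 := Subgroup.card_eq_one.2 this
      rw [hP] at h1
      omega
    generalize H.index = i at *
    unfold Nat.ModEq at hmod
    interval_cases i <;> omega
  rw [← h4]
  refine exists_injective_hom_perm_of_normalCore_eq_bot H (hN _ inferInstance ?_)
  refine (Subgroup.card_dvd_of_le H.normalCore_le).trans ?_
  rw [h4] at hmul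
  rcases hG with h | h
  · exact ⟨2, by omega⟩
  · exact ⟨1, by omega⟩

theorem exists_injective_hom_perm_five {G : Type*} [Group G] [Finite G]
    (hG : Nat.card G = 60) (hN : ∀ K : Subgroup G, K.Normal → K = ⊥ ∨ K = ⊤) :
    ∃ f : G →* Equiv.Perm (Fin 5), Function.Injective f := by
  have : Fact (Nat.Prime 2) := ⟨Nat.prime_two⟩
  let P : Sylow 2 G := default
  have hP : Nat.card P = 4 := by
    rw [P.card_eq_multiplicity, hG, Nat.factorization_def _ Nat.prime_two,
      show 60 = 2 ^ 2 * 15 by norm_num, padicValNat.mul (by norm_num) (by norm_num),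
      padicValNat.prime_pow, padicValNat.eq_zero_of_not_dvd (by norm_num)]
    norm_num
  set H := Subgroup.normalizer (P : Set G)
  have hmul := H.index_mul_card
  have h4 : 4 ∣ Nat.card H := hP ▸ Subgroup.card_dvd_of_le Subgroup.le_normalizer
  obtain ⟨m, hm⟩ := h4
  have hdvd : H.index ∣ 15 := ⟨m, by rw [hG, hm] at hmul; linarith⟩
  have htop : H.index ≠ 1 → H.normalCore = ⊥ := fun h1 ↦
    (hN _ inferInstance).resolve_right fun h ↦
      h1 (Subgroup.index_eq_one.2 (top_le_iff.1 (h ▸ H.normalCore_le)))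
  have hne1 : H.index ≠ 1 := fun h1 ↦ by
    have hn : (P : Subgroup G).Normal :=
      Subgroup.normalizer_eq_top_iff.1 (Subgroup.index_eq_one.1 h1)
    rcases hN P hn with h | h
    · have h := Subgroup.card_eq_one.2 h
      omega
    · have h := Subgroup.card_eq_iff_eq_top _ |>.2 h
      omega
  obtain ⟨f, hf⟩ := exists_injective_hom_perm_of_normalCore_eq_bot H (htop hne1)
  have hne3 : H.index ≠ 3 := fun h3 ↦ by
    have h := Nat.card_le_card_of_injective f hf
    rw [h3, Nat.card_perm, Nat.card_fin, hG] at h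
    exact absurd h (by decide)
  have hne15 : H.index ≠ 15 := fun h15 ↦ by
    have hPH : (P : Subgroup G) = H :=
      Subgroup.eq_of_le_of_card_ge Subgroup.le_normalizer (by rw [h15] at hmul; omega)
    have hcomm : IsMulCommutative P :=
      IsPGroup.isMulCommutative_of_card_eq_prime_sq (p := 2) (by rw [hP]; norm_num)
    have hle : H ≤ Subgroup.centralizer (P : Set G) := by
      rw [← hPH]; exact Subgroup.le_centralizer _
    have hc := MonoidHom.ker_transferSylow_isComplement' P hle
    have hmul := hc.card_mul_card
    rcases hN _ (MonoidHom.transferSylow P hle).normal_ker with h | h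
    · rw [h, Subgroup.card_bot] at hmul
      omega
    · rw [h, Subgroup.card_top, hP] at hmul
      omega
  have h5 : H.index = 5 := by
    have hle := Nat.le_of_dvd (by norm_num) hdvd
    generalize H.index = i at *
    interval_cases i <;> omega
  exact h5 ▸ ⟨f, hf⟩

theorem sum_card_inf_stabilizer {G X : Type*} [Group G] [Finite G] [MulAction G X] [Fintype X]
    (hfix : ∀ g : G, g ≠ 1 → (MulAction.fixedBy X g).ncard = 2) (K : Subgroup G) :
    ∑ x : X, Nat.card (K ⊓ MulAction.stabilizer G x : Subgroup G) + 2 =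
      Nat.card X + 2 * Nat.card K := by
  classical
  have := Fintype.ofFinite G
  have h1 (x : X) : Nat.card (K ⊓ MulAction.stabilizer G x : Subgroup G) =
      ∑ g : G, if g ∈ K ∧ g • x = x then 1 else 0 := by
    rw [Finset.sum_boole, Nat.cast_id, ← Fintype.card_subtype, ← Nat.card_eq_fintype_card]
    rfl
  have h2 (g : G) : (∑ x : X, if g ∈ K ∧ g • x = x then 1 else 0) =
      if g ∈ K then (MulAction.fixedBy X g).ncard else 0 := by
    split_ifs with hg
    · simp only [hg, true_and]
      rw [Finset.sum_boole, Nat.cast_id, ← Fintype.card_subtype, ← Nat.card_eq_fintype_card]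
      rfl
    · simp [hg]
  have h3 : Nat.card K = ∑ g : G, if g ∈ K then 1 else 0 := by
    rw [Finset.sum_boole, Nat.cast_id, ← Fintype.card_subtype, ← Nat.card_eq_fintype_card]
  have h4 : (MulAction.fixedBy X (1 : G)).ncard = Nat.card X := by
    rw [MulAction.fixedBy_one_eq_univ, Set.ncard_univ]
  simp_rw [h1]
  rw [Finset.sum_comm, h3]
  simp_rw [h2]
  rw [← Finset.add_sum_erase _ _ (Finset.mem_univ (1 : G)),
    ← Finset.add_sum_erase _ (fun g ↦ if g ∈ K then 1 else 0) (Finset.mem_univ (1 : G)),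
    if_pos K.one_mem, if_pos K.one_mem, h4, add_right_comm, mul_add, mul_one,
    Finset.mul_sum, ← add_assoc]
  congr 1
  refine Finset.sum_congr rfl fun g hg ↦ ?_
  rw [hfix g (Finset.ne_of_mem_erase hg)]
  simp

theorem card_inf_stabilizer_smul {G X : Type*} [Group G] [MulAction G X] (K : Subgroup G)
    [hK : K.Normal] (g : G) (x : X) :
    Nat.card (K ⊓ MulAction.stabilizer G (g • x) : Subgroup G) =
      Nat.card (K ⊓ MulAction.stabilizer G x : Subgroup G) := by
  have hmap : K ⊓ MulAction.stabilizer G (g • x) =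
      (K ⊓ MulAction.stabilizer G x).map (MulAut.conj g).toMonoidHom := by
    rw [Subgroup.map_inf _ _ _ (MulAut.conj g).injective,
      ← MulAction.stabilizer_smul_eq_stabilizer_map_conj]
    congr 1
    exact (Subgroup.normal_iff_map_conj_eq.1 hK g).symm
  rw [hmap]
  exact Subgroup.card_map_of_injective (MulAut.conj g).injective

theorem sum_eq_sum_orbits {G X : Type*} [Group G] [MulAction G X] [Fintype X]
    [Fintype (MulAction.orbitRel.Quotient G X)] (f : X → ℕ) (hf : ∀ (g : G) x, f (g • x) = f x) :
    ∑ x, f x = ∑ ω : MulAction.orbitRel.Quotient G X, (MulAction.orbit G ω.out).ncard * f ω.out := by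
  classical
  rw [← Finset.sum_fiberwise (s := Finset.univ)
    (g := (Quotient.mk'' : X → MulAction.orbitRel.Quotient G X))]
  refine Finset.sum_congr rfl fun ω _ ↦ ?_
  have hmem (x : X) : (Quotient.mk'' x : MulAction.orbitRel.Quotient G X) = ω ↔
      x ∈ MulAction.orbit G ω.out := by
    rw [← MulAction.orbitRel_apply, ← Quotient.eq'', Quotient.out_eq']
  rw [Finset.sum_congr rfl (g := fun _ ↦ f ω.out), Finset.sum_const, smul_eq_mul,
    Set.ncard_eq_toFinset_card']
  · congr 2
    ext x
    simp [hmem]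
  · intro x hx
    obtain ⟨g, rfl⟩ := (hmem x).1 (Finset.mem_filter.1 hx).2
    exact hf g _

theorem ncard_orbit_mul_card_stabilizer {G X : Type*} [Group G] [MulAction G X] (x : X) :
    (MulAction.orbit G x).ncard * Nat.card (MulAction.stabilizer G x) = Nat.card G := by
  rw [← MulAction.index_stabilizer, Subgroup.index_mul_card]

theorem orbit_and_stabilizer_cards_of_three_orbits {N : ℕ} {r s : Fin 3 → ℕ} (hr : Monotone r)
    (hr2 : ∀ i, 2 ≤ r i) (hrs : ∀ i, s i * r i = N) (hs : ∑ i, s i = N + 2) :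
    (r 0 = 2 ∧ r 1 = 2 ∧ s 2 = 2) ∨
    (N = 12 ∧ r 0 = 2 ∧ r 1 = 3 ∧ r 2 = 3) ∨
    (N = 24 ∧ r 0 = 2 ∧ r 1 = 3 ∧ r 2 = 4) ∨
    (N = 60 ∧ r 0 = 2 ∧ r 1 = 3 ∧ r 2 = 5) := by
  have h01 : r 0 ≤ r 1 := hr (by decide)
  have h12 : r 1 ≤ r 2 := hr (by decide)
  have h0 := hr2 0
  have e0 := hrs 0
  have e1 := hrs 1
  have e2 := hrs 2
  rw [Fin.sum_univ_three] at hs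
  generalize r 0 = a, r 1 = b, r 2 = c, s 0 = x, s 1 = y, s 2 = z at *
  have ha : a = 2 := by
    by_contra h
    have : 3 ≤ a := by omega
    nlinarith
  subst ha
  have hb : b ≤ 3 := by
    by_contra! h
    nlinarith
  interval_cases b
  · left; omega
  · right
    have hc : c < 6 := by
      by_contra! h
      nlinarith
    interval_cases c <;> omega

theorem mulEquiv_of_three_orbits {G X : Type*} [Group G] [Finite G] [MulAction G X]
    (hfix : ∀ g : G, g ≠ 1 → (MulAction.fixedBy X g).ncard = 2)
    (hst : ∀ x : X, MulAction.stabilizer G x ≠ ⊥)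
    (hcyc : ∀ x : X, IsCyclic (MulAction.stabilizer G x)) (x : Fin 3 → X)
    (horbit : ∀ y, ∃ i, y ∈ MulAction.orbit G (x i))
    (hmono : Monotone fun i ↦ Nat.card (MulAction.stabilizer G (x i)))
    (hcount : ∀ K : Subgroup G, K.Normal →
      ∑ i, (MulAction.orbit G (x i)).ncard *
        Nat.card (K ⊓ MulAction.stabilizer G (x i) : Subgroup G) + 2 =
      ∑ i, (MulAction.orbit G (x i)).ncard + 2 * Nat.card K) :
    (∃ n : ℕ, 1 ≤ n ∧ Nonempty (G ≃* DihedralGroup n)) ∨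
    Nonempty (G ≃* alternatingGroup (Fin 4)) ∨
    Nonempty (G ≃* Equiv.Perm (Fin 4)) ∨
    Nonempty (G ≃* alternatingGroup (Fin 5)) := by
  have hrs (i : Fin 3) := ncard_orbit_mul_card_stabilizer (G := G) (x i)
  have hr2 (i : Fin 3) : 2 ≤ Nat.card (MulAction.stabilizer G (x i)) :=
    Subgroup.one_lt_card_iff_ne_bot _ |>.2 (hst _)
  have hdvd (K : Subgroup G) (i : Fin 3) :
      Nat.card (K ⊓ MulAction.stabilizer G (x i) : Subgroup G) ∣
        Nat.card (MulAction.stabilizer G (x i)) := Subgroup.card_dvd_of_le inf_le_right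
  have hsum : ∑ i, (MulAction.orbit G (x i)).ncard = Nat.card G + 2 := by
    have h := hcount ⊤ inferInstance
    simp only [top_inf_eq, hrs, Subgroup.card_top, Fin.sum_univ_three] at h ⊢
    omega
  have hK (K : Subgroup G) (hKn : K.Normal) := hcount K hKn
  have hcases := orbit_and_stabilizer_cards_of_three_orbits hmono hr2 hrs hsum
  simp only [Fin.sum_univ_three] at hcases hsum hK
  rcases hcases with ⟨h0, h1, h2⟩ | ⟨hN, h0, h1, h2⟩ | ⟨hN, h0, h1, h2⟩ | ⟨hN, h0, h1, h2⟩
  · left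
    have hindex : (MulAction.stabilizer G (x 2)).index = 2 := by
      rw [MulAction.index_stabilizer, h2]
    have hnormal := Subgroup.normal_of_index_eq_two hindex
    have := hcyc (x 2)
    refine ⟨_, Nat.card_pos, nonempty_mulEquiv_dihedralGroup _ hindex fun g hg ↦ ?_⟩
    have hg1 : g ≠ 1 := fun h ↦ hg (h ▸ one_mem _)
    obtain ⟨y, hy⟩ : (MulAction.fixedBy X g).Nonempty :=
      Set.nonempty_of_ncard_ne_zero (by rw [hfix g hg1]; norm_num)
    have hgy : g ∈ MulAction.stabilizer G y := hy
    have hsq (h : Nat.card (MulAction.stabilizer G y) = 2) : g * g = 1 := by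
      rw [← pow_two, ← h]
      exact congrArg Subtype.val (pow_card_eq_one' (x := (⟨g, hgy⟩ : MulAction.stabilizer G y)))
    obtain ⟨i, a, rfl⟩ := horbit y
    have hcard := card_inf_stabilizer_smul (⊤ : Subgroup G) a (x i)
    simp only [top_inf_eq] at hcard
    match i with
    | 0 => exact hsq (hcard.trans h0)
    | 1 => exact hsq (hcard.trans h1)
    | 2 =>
      refine absurd ?_ hg
      rw [MulAction.stabilizer_smul_eq_stabilizer_map_conj] at hgy
      exact (Subgroup.normal_iff_map_conj_eq.1 hnormal a).le hgy
  all_goals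
    have e0 := hrs 0
    have e1 := hrs 1
    have e2 := hrs 2
    have hd (K : Subgroup G) := And.intro (hdvd K 0) (And.intro (hdvd K 1) (hdvd K 2))
    simp only [h0, h1, h2, hN] at e0 e1 e2 hd
    generalize (MulAction.orbit G (x 0)).ncard = s0, (MulAction.orbit G (x 1)).ncard = s1,
      (MulAction.orbit G (x 2)).ncard = s2 at *
  · obtain rfl : s0 = 6 := by omega
    obtain rfl : s1 = 4 := by omega
    obtain rfl : s2 = 4 := by omega
    obtain ⟨f, hf⟩ := exists_injective_hom_perm_four (G := G) (.inl hN) fun K hKn hK6 ↦ by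
      have h := hK K hKn
      obtain ⟨d0, d1, d2⟩ := hd K
      rw [← Subgroup.card_eq_one]
      rw [Nat.dvd_prime Nat.prime_two] at d0
      rw [Nat.dvd_prime Nat.prime_three] at d1 d2
      replace hK6 := Nat.mem_divisors.2 ⟨hK6, by norm_num⟩
      rw [show Nat.divisors 6 = {1, 2, 3, 6} by decide] at hK6
      simp only [Finset.mem_insert, Finset.mem_singleton] at hK6
      rcases d0 with d0 | d0 <;> rcases d1 with d1 | d1 <;> rcases d2 with d2 | d2 <;>
        rw [d0, d1, d2] at h <;> omega
    exact .inr (.inl (nonempty_mulEquiv_alternatingGroup f hf (by rw [hN]; rfl)))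
  · obtain rfl : s0 = 12 := by omega
    obtain rfl : s1 = 8 := by omega
    obtain rfl : s2 = 6 := by omega
    obtain ⟨f, hf⟩ := exists_injective_hom_perm_four (G := G) (.inr hN) fun K hKn hK6 ↦ by
      have h := hK K hKn
      obtain ⟨d0, d1, d2⟩ := hd K
      rw [← Subgroup.card_eq_one]
      rw [Nat.dvd_prime Nat.prime_two] at d0
      rw [Nat.dvd_prime Nat.prime_three] at d1
      have := Nat.pos_of_dvd_of_pos d2 (by norm_num)
      replace hK6 := Nat.mem_divisors.2 ⟨hK6, by norm_num⟩
      rw [show Nat.divisors 6 = {1, 2, 3, 6} by decide] at hK6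
      simp only [Finset.mem_insert, Finset.mem_singleton] at hK6
      rcases d0 with d0 | d0 <;> rcases d1 with d1 | d1 <;> rw [d0, d1] at h <;> omega
    exact .inr (.inr (.inl (nonempty_mulEquiv_perm f hf (by rw [hN]; rfl))))
  · obtain rfl : s0 = 30 := by omega
    obtain rfl : s1 = 20 := by omega
    obtain rfl : s2 = 12 := by omega
    obtain ⟨f, hf⟩ := exists_injective_hom_perm_five (G := G) hN fun K hKn ↦ by
      have h := hK K hKn
      obtain ⟨d0, d1, d2⟩ := hd K
      have hK60 : Nat.card K ∣ 60 := hN ▸ K.card_subgroup_dvd_card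
      replace hK60 := Nat.mem_divisors.2 ⟨hK60, by norm_num⟩
      rw [show Nat.divisors 60 = {1, 2, 3, 4, 5, 6, 10, 12, 15, 20, 30, 60} by decide] at hK60
      simp only [Finset.mem_insert, Finset.mem_singleton] at hK60
      rw [← Subgroup.card_eq_one, ← Subgroup.card_eq_iff_eq_top, hN]
      rw [Nat.dvd_prime Nat.prime_two] at d0
      rw [Nat.dvd_prime Nat.prime_three] at d1
      rw [Nat.dvd_prime Nat.prime_five] at d2
      rcases d0 with d0 | d0 <;> rcases d1 with d1 | d1 <;> rcases d2 with d2 | d2 <;>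
        rw [d0, d1, d2] at h <;> omega
    exact .inr (.inr (.inr (nonempty_mulEquiv_alternatingGroup f hf (by rw [hN]; rfl))))

theorem classification_of_two_fixed_points {G X : Type*} [Group G] [Finite G] [MulAction G X]
    [Finite X] (hfix : ∀ g : G, g ≠ 1 → (MulAction.fixedBy X g).ncard = 2)
    (hst : ∀ x : X, MulAction.stabilizer G x ≠ ⊥)
    (hcyc : ∀ x : X, IsCyclic (MulAction.stabilizer G x)) :
    IsCyclic G ∨
    (∃ n : ℕ, 1 ≤ n ∧ Nonempty (G ≃* DihedralGroup n)) ∨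
    Nonempty (G ≃* alternatingGroup (Fin 4)) ∨
    Nonempty (G ≃* Equiv.Perm (Fin 4)) ∨
    Nonempty (G ≃* alternatingGroup (Fin 5)) := by
  classical
  rcases subsingleton_or_nontrivial G with hG | hG
  · exact .inl isCyclic_of_subsingleton
  obtain ⟨g, hg⟩ := exists_ne (1 : G)
  obtain ⟨x₀, -⟩ : (MulAction.fixedBy X g).Nonempty :=
    Set.nonempty_of_ncard_ne_zero (by rw [hfix g hg]; norm_num)
  have := Fintype.ofFinite X
  let Ω := MulAction.orbitRel.Quotient G X
  have : Fintype Ω := Fintype.ofFinite Ω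
  have : Nonempty Ω := ⟨Quotient.mk'' x₀⟩
  have hX : Nat.card X = ∑ ω : Ω, (MulAction.orbit G ω.out).ncard := by
    simpa using sum_eq_sum_orbits (G := G) (X := X) (fun _ ↦ 1) (fun _ _ ↦ rfl)
  have hcount (K : Subgroup G) (hK : K.Normal) :
      ∑ ω : Ω, (MulAction.orbit G ω.out).ncard *
        Nat.card (K ⊓ MulAction.stabilizer G ω.out : Subgroup G) + 2 =
      ∑ ω : Ω, (MulAction.orbit G ω.out).ncard + 2 * Nat.card K := by
    rw [← hX, ← sum_card_inf_stabilizer hfix K,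
      sum_eq_sum_orbits (G := G) (X := X) _ (card_inf_stabilizer_smul K)]
  have hrs (ω : Ω) := ncard_orbit_mul_card_stabilizer (G := G) ω.out
  have hr2 (ω : Ω) : 2 ≤ Nat.card (MulAction.stabilizer G ω.out) :=
    Subgroup.one_lt_card_iff_ne_bot _ |>.2 (hst _)
  have hN : 2 ≤ Nat.card G := Finite.one_lt_card
  have hs1 (ω : Ω) : 1 ≤ (MulAction.orbit G ω.out).ncard := by
    by_contra! h
    have := hrs ω
    rw [Nat.lt_one_iff.1 h, zero_mul] at this
    omega
  have htotal : Fintype.card Ω * Nat.card G + 2 =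
      ∑ ω : Ω, (MulAction.orbit G ω.out).ncard + 2 * Nat.card G := by
    have h := hcount ⊤ inferInstance
    simpa only [top_inf_eq, hrs, Finset.sum_const, Finset.card_univ, smul_eq_mul,
      Subgroup.card_top] using h
  have hle : 2 * ∑ ω : Ω, (MulAction.orbit G ω.out).ncard ≤ Fintype.card Ω * Nat.card G := by
    rw [Finset.mul_sum, ← smul_eq_mul, ← Finset.card_univ]
    refine Finset.sum_le_card_nsmul _ _ _ fun ω _ ↦ ?_
    nlinarith [hrs ω, hr2 ω, hs1 ω]
  have hge : Fintype.card Ω ≤ ∑ ω : Ω, (MulAction.orbit G ω.out).ncard := by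
    simpa using Finset.card_nsmul_le_sum Finset.univ
      (fun ω : Ω ↦ (MulAction.orbit G ω.out).ncard) 1 fun ω _ ↦ hs1 ω
  have hpos : 0 < Fintype.card Ω := Fintype.card_pos
  have hlt : Fintype.card Ω < 4 := by
    by_contra! h
    nlinarith
  obtain h | h | h : Fintype.card Ω = 1 ∨ Fintype.card Ω = 2 ∨ Fintype.card Ω = 3 := by omega
  · rw [h] at htotal hge
    omega
  · left
    rw [h] at htotal
    let ω : Ω := Quotient.mk'' x₀
    have hω : (MulAction.orbit G ω.out).ncard = 1 := by
      have h1 := Finset.card_nsmul_le_sum (Finset.univ.erase ω)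
        (fun ω : Ω ↦ (MulAction.orbit G ω.out).ncard) 1 fun ω _ ↦ hs1 ω
      have h2 := Finset.add_sum_erase Finset.univ
        (fun ω : Ω ↦ (MulAction.orbit G ω.out).ncard) (Finset.mem_univ ω)
      simp only [Finset.card_erase_of_mem (Finset.mem_univ ω), Finset.card_univ, h,
        smul_eq_mul] at h1 h2
      have := hs1 ω
      omega
    have htop : MulAction.stabilizer G ω.out = ⊤ := by
      rw [← Subgroup.index_eq_one, MulAction.index_stabilizer, hω]
    have := hcyc ω.out
    rw [htop] at this
    exact isCyclic_of_surjective Subgroup.topEquiv Subgroup.topEquiv.surjective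
  · right
    let e₀ : Fin 3 ≃ Ω := (Fintype.equivFinOfCardEq h).symm
    let e : Fin 3 ≃ Ω := (Tuple.sort fun i ↦
      Nat.card (MulAction.stabilizer G (e₀ i).out)).trans e₀
    refine mulEquiv_of_three_orbits hfix hst hcyc (fun i ↦ (e i).out) (fun y ↦ ?_)
      (Tuple.monotone_sort fun i ↦ Nat.card (MulAction.stabilizer G (e₀ i).out)) fun K hK ↦ ?_
    · refine ⟨e.symm (Quotient.mk'' y), ?_⟩
      rw [e.apply_symm_apply, ← MulAction.orbitRel_apply, ← Quotient.eq'', Quotient.out_eq']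
    · have := hcount K hK
      rwa [← e.sum_comp, ← e.sum_comp (fun ω : Ω ↦ (MulAction.orbit G ω.out).ncard)] at this

theorem exists_orthogonal_mulVec_single_eq {p : Fin 3 → ℝ} (hp : p ⬝ᵥ p = 1) :
    ∃ M : Matrix (Fin 3) (Fin 3) ℝ, Mᵀ * M = 1 ∧ M *ᵥ Pi.single 2 1 = p := by
  have hv : Orthonormal ℝ (({2} : Set (Fin 3)).domRestrict
      fun _ ↦ (WithLp.toLp 2 p : EuclideanSpace ℝ (Fin 3))) := by
    refine ⟨fun i ↦ ?_, fun i j hij ↦ absurd (Subsingleton.elim i j) hij⟩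
    have : ‖(WithLp.toLp 2 p : EuclideanSpace ℝ (Fin 3))‖ ^ 2 = 1 := by
      rw [EuclideanSpace.real_norm_sq_eq, ← hp]
      simp [dotProduct, sq]
    exact (pow_eq_one_iff_of_nonneg (norm_nonneg _) two_ne_zero).1 this
  obtain ⟨b, hb⟩ := hv.exists_orthonormalBasis_extension_of_card_eq (by simp)
  refine ⟨Matrix.of fun i j ↦ b j i, ?_, ?_⟩
  · ext i j
    have h := b.inner_eq_ite i j
    rw [PiLp.inner_apply] at h
    simpa [Matrix.mul_apply, Matrix.one_apply, mul_comm] using h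
  · ext i
    have h := hb 2 rfl
    simp [h]

theorem eq_of_mulVec_single_two_eq {A : Matrix (Fin 3) (Fin 3) ℝ} (hA : Aᵀ * A = 1)
    (hdet : A.det = 1) (hfix : A *ᵥ Pi.single 2 1 = Pi.single 2 1) :
    A = !![A 0 0, -A 1 0, 0; A 1 0, A 0 0, 0; 0, 0, 1] := by
  have h02 : A 0 2 = 0 := by simpa using congrFun hfix 0
  have h12 : A 1 2 = 0 := by simpa using congrFun hfix 1
  have h22 : A 2 2 = 1 := by simpa using congrFun hfix 2
  have hA' (i j : Fin 3) := congrFun (congrFun hA i) j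
  simp only [Matrix.mul_apply, Fin.sum_univ_three, Matrix.transpose_apply, Matrix.one_apply] at hA'
  have h20 : A 2 0 = 0 := by simpa [h02, h12, h22] using hA' 0 2
  have h21 : A 2 1 = 0 := by simpa [h02, h12, h22] using hA' 1 2
  have h00 := hA' 0 0
  have h11 := hA' 1 1
  rw [Matrix.det_fin_three] at hdet
  simp only [h02, h12, h22, h20, h21, if_true] at h00 h11 hdet
  have hsq : (A 0 0 - A 1 1) ^ 2 + (A 0 1 + A 1 0) ^ 2 = 0 := by linarith
  have h1 : A 1 1 = A 0 0 := by nlinarith [sq_nonneg (A 0 0 - A 1 1), sq_nonneg (A 0 1 + A 1 0)]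
  have h2 : A 0 1 = -A 1 0 := by nlinarith [sq_nonneg (A 0 0 - A 1 1), sq_nonneg (A 0 1 + A 1 0)]
  ext i j
  fin_cases i <;> fin_cases j <;> simp [h02, h12, h22, h20, h21, h1, h2]

theorem orthogonal_conj {n R : Type*} [Fintype n] [DecidableEq n] [CommRing R] {A M : Matrix n n R}
    (hA : Aᵀ * A = 1) (hdet : A.det = 1) (hM : Mᵀ * M = 1) :
    (Mᵀ * A * M)ᵀ * (Mᵀ * A * M) = 1 ∧ (Mᵀ * A * M).det = 1 := by
  have hM' : M * Mᵀ = 1 := mul_eq_one_comm.1 hM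
  constructor
  · calc (Mᵀ * A * M)ᵀ * (Mᵀ * A * M) = Mᵀ * (Aᵀ * (M * Mᵀ) * A) * M := by
          simp only [Matrix.transpose_mul, Matrix.transpose_transpose, Matrix.mul_assoc]
      _ = 1 := by rw [hM', Matrix.mul_one, hA, Matrix.mul_one, hM]
  · rw [Matrix.det_mul, Matrix.det_mul, hdet, mul_one, ← Matrix.det_mul, hM, Matrix.det_one]

theorem exists_unit_fixed {A : Matrix (Fin 3) (Fin 3) ℝ} (hA : Aᵀ * A = 1) (hdet : A.det = 1) :
    ∃ p, p ⬝ᵥ p = 1 ∧ A *ᵥ p = p := by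
  have h : (A - 1).det = 0 := by
    have h1 : (A - 1).det = (1 - A).det := by
      calc (A - 1).det = Aᵀ.det * (A - 1).det := by rw [Matrix.det_transpose, hdet, one_mul]
        _ = ((1 - A)ᵀ).det := by
          rw [← Matrix.det_mul, Matrix.mul_sub, hA, Matrix.mul_one, Matrix.transpose_sub,
            Matrix.transpose_one]
        _ = (1 - A).det := Matrix.det_transpose _
    have h2 : (1 - A).det = -(A - 1).det := by
      rw [← neg_sub, Matrix.det_neg]
      simp [pow_succ]
    linarith
  obtain ⟨v, hv, hAv⟩ := Matrix.exists_mulVec_eq_zero_iff.2 h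
  rw [Matrix.sub_mulVec, Matrix.one_mulVec, sub_eq_zero] at hAv
  have hpos : 0 < v ⬝ᵥ v := by simpa using Matrix.dotProduct_star_self_pos_iff.2 hv
  refine ⟨(√(v ⬝ᵥ v))⁻¹ • v, ?_, ?_⟩
  · rw [smul_dotProduct, dotProduct_smul, smul_eq_mul, smul_eq_mul, ← mul_assoc, ← mul_inv,
      Real.mul_self_sqrt hpos.le, inv_mul_cancel₀ hpos.ne']
  · rw [Matrix.mulVec_smul, hAv]

theorem eq_or_eq_neg_of_fixed {A : Matrix (Fin 3) (Fin 3) ℝ} (hA : Aᵀ * A = 1) (hdet : A.det = 1)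
    (hA1 : A ≠ 1) {p q : Fin 3 → ℝ} (hp : p ⬝ᵥ p = 1) (hq : q ⬝ᵥ q = 1) (hAp : A *ᵥ p = p)
    (hAq : A *ᵥ q = q) : q = p ∨ q = -p := by
  obtain ⟨M, hM, rfl⟩ := exists_orthogonal_mulVec_single_eq hp
  have hM' : M * Mᵀ = 1 := mul_eq_one_comm.1 hM
  obtain ⟨hR, hRdet⟩ := orthogonal_conj hA hdet hM
  have hRfix : (Mᵀ * A * M) *ᵥ Pi.single 2 1 = Pi.single 2 1 := by
    rw [← Matrix.mulVec_mulVec, ← Matrix.mulVec_mulVec, hAp, Matrix.mulVec_mulVec, hM,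
      Matrix.one_mulVec]
  have hform := eq_of_mulVec_single_two_eq hR hRdet hRfix
  have hRv : (Mᵀ * A * M) *ᵥ (Mᵀ *ᵥ q) = Mᵀ *ᵥ q := by
    rw [Matrix.mulVec_mulVec, Matrix.mul_assoc, hM', Matrix.mul_one, ← Matrix.mulVec_mulVec, hAq]
  have hvv : (Mᵀ *ᵥ q) ⬝ᵥ (Mᵀ *ᵥ q) = 1 := by
    rw [Matrix.dotProduct_mulVec, Matrix.vecMul_transpose, Matrix.mulVec_mulVec, hM',
      Matrix.one_mulVec, hq]
  have hqv : q = M *ᵥ (Mᵀ *ᵥ q) := by rw [Matrix.mulVec_mulVec, hM', Matrix.one_mulVec]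
  have hne : Mᵀ * A * M ≠ 1 := fun h ↦ hA1 <| by
    calc A = (M * Mᵀ) * A * (M * Mᵀ) := by rw [hM', Matrix.one_mul, Matrix.mul_one]
      _ = M * (Mᵀ * A * M) * Mᵀ := by simp only [Matrix.mul_assoc]
      _ = 1 := by rw [h, Matrix.mul_one, hM']
  rw [hqv]
  generalize Mᵀ *ᵥ q = v at *
  generalize Mᵀ * A * M = R at *
  have h0 := congrFun hRv 0
  have h1 := congrFun hRv 1
  rw [hform] at h0 h1
  simp only [mulVec, dotProduct, Fin.isValue, of_apply, cons_val', cons_val_fin_one, cons_val_zero,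
    Fin.sum_univ_three, cons_val_one, neg_mul, cons_val, zero_mul, add_zero] at h0 h1
  have hcol : R 0 0 ^ 2 + R 1 0 ^ 2 = 1 := by
    have h := congrFun (congrFun hR 0) 0
    rw [hform] at h
    simpa [Matrix.mul_apply, Fin.sum_univ_three, sq] using h
  have hR0 : R 0 0 ≠ 1 := fun h ↦ hne <| by
    have h' : R 1 0 = 0 := by
      rw [h] at hcol
      nlinarith
    rw [hform, h, h']
    ext i j
    fin_cases i <;> fin_cases j <;> simp
  have hlt : R 0 0 < 1 := lt_of_le_of_ne (by nlinarith) hR0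
  have hprod : (2 - 2 * R 0 0) * (v 0 ^ 2 + v 1 ^ 2) = 0 := by
    linear_combination (R 0 0 * v 0 - R 1 0 * v 1 - v 0) * h0 +
      (R 1 0 * v 0 + R 0 0 * v 1 - v 1) * h1 - (v 0 ^ 2 + v 1 ^ 2) * hcol
  have hsq : v 0 ^ 2 + v 1 ^ 2 = 0 := (mul_eq_zero.1 hprod).resolve_left (by linarith)
  have hv0 : v 0 = 0 := by nlinarith
  have hv1 : v 1 = 0 := by nlinarith
  simp only [dotProduct, Fin.sum_univ_three, hv0, hv1, mul_zero, zero_add] at hvv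
  rw [← Matrix.mulVec_neg]
  rcases mul_self_eq_one_iff.1 hvv with h | h
  · left; congr 1; ext i; fin_cases i <;> simp [hv0, hv1, h]
  · right; congr 1; ext i; fin_cases i <;> simp [hv0, hv1, h]

theorem isCyclic_of_common_fixed {H : Type*} [Group H] [Finite H]
    (ρ : H →* Matrix (Fin 3) (Fin 3) ℝ) (hρ : Function.Injective ρ)
    (hSO : ∀ h, (ρ h)ᵀ * ρ h = 1 ∧ (ρ h).det = 1) {p : Fin 3 → ℝ} (hp : p ⬝ᵥ p = 1)
    (hfix : ∀ h, ρ h *ᵥ p = p) : IsCyclic H := by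
  obtain ⟨M, hM, rfl⟩ := exists_orthogonal_mulVec_single_eq hp
  have hM' : M * Mᵀ = 1 := mul_eq_one_comm.1 hM
  let R : H → Matrix (Fin 3) (Fin 3) ℝ := fun h ↦ Mᵀ * ρ h * M
  have hform (h : H) : R h = !![R h 0 0, -R h 1 0, 0; R h 1 0, R h 0 0, 0; 0, 0, 1] := by
    obtain ⟨h1, h2⟩ := orthogonal_conj (hSO h).1 (hSO h).2 hM
    refine eq_of_mulVec_single_two_eq h1 h2 ?_
    rw [← Matrix.mulVec_mulVec, ← Matrix.mulVec_mulVec, hfix, Matrix.mulVec_mulVec, hM,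
      Matrix.one_mulVec]
  have hmul (h k : H) : R (h * k) = R h * R k := by
    calc R (h * k) = Mᵀ * ρ h * 1 * ρ k * M := by simp only [R, map_mul, mul_assoc, one_mul]
      _ = R h * R k := by rw [← hM']; simp only [R, mul_assoc]
  have hρR (h : H) : ρ h = M * R h * Mᵀ := by
    calc ρ h = (M * Mᵀ) * ρ h * (M * Mᵀ) := by rw [hM', one_mul, mul_one]
      _ = M * R h * Mᵀ := by simp only [R, mul_assoc]
  let f : H →* ℂ :=
    { toFun h := ⟨R h 0 0, R h 1 0⟩
      map_one' := by
        have : R 1 = 1 := by simp only [R, map_one, mul_one, hM]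
        rw [this]
        apply Complex.ext <;> simp
      map_mul' h k := by
        rw [hmul, Matrix.mul_apply, Matrix.mul_apply, Fin.sum_univ_three, Fin.sum_univ_three]
        rw [hform h, hform k]
        apply Complex.ext <;> simp
        · ring
        · ring }
  refine isCyclic_of_injective_ringHom f fun h k hhk ↦ hρ ?_
  have h0 : R h 0 0 = R k 0 0 := congrArg Complex.re hhk
  have h1 : R h 1 0 = R k 1 0 := congrArg Complex.im hhk
  rw [hρR h, hρR k, hform h, hform k, h0, h1]

/-- The unit vectors fixed by a nontrivial element of a matrix representation. -/
def poles {G : Type*} [Group G] (ρ : G →* Matrix (Fin 3) (Fin 3) ℝ) : Set (Fin 3 → ℝ) :=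
  {p | p ⬝ᵥ p = 1 ∧ ∃ g, g ≠ 1 ∧ ρ g *ᵥ p = p}

/-- The action of a group on the poles of an orthogonal representation. -/
abbrev polesMulAction {G : Type*} [Group G] (ρ : G →* Matrix (Fin 3) (Fin 3) ℝ)
    (hρ : ∀ g, (ρ g)ᵀ * ρ g = 1) : MulAction G (poles ρ) where
  smul g p := ⟨ρ g *ᵥ p.1, by
    obtain ⟨hp, h, hh, hhp⟩ := p.2
    refine ⟨?_, g * h * g⁻¹, by simpa using hh, ?_⟩
    · rw [Matrix.dotProduct_mulVec, ← Matrix.mulVec_transpose, Matrix.mulVec_mulVec, hρ,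
        Matrix.one_mulVec, hp]
    · rw [Matrix.mulVec_mulVec, ← map_mul, inv_mul_cancel_right, map_mul, ← Matrix.mulVec_mulVec,
        hhp]⟩
  one_smul p := Subtype.ext <| by
    change ρ 1 *ᵥ p.1 = p.1
    rw [map_one, Matrix.one_mulVec]
  mul_smul g h p := Subtype.ext <| by
    change ρ (g * h) *ᵥ p.1 = ρ g *ᵥ (ρ h *ᵥ p.1)
    rw [map_mul, Matrix.mulVec_mulVec]

theorem finite_subgroups_of_SO3
    (G : Subgroup (GL (Fin 3) ℝ)) [Finite G]
    (hSO : ∀ g ∈ G, (g : Matrix (Fin 3) (Fin 3) ℝ)ᵀ * (g : Matrix (Fin 3) (Fin 3) ℝ) = 1 ∧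
      (g : Matrix (Fin 3) (Fin 3) ℝ).det = 1) :
    IsCyclic G ∨
    (∃ n : ℕ, 1 ≤ n ∧ Nonempty (G ≃* DihedralGroup n)) ∨
    Nonempty (G ≃* alternatingGroup (Fin 4)) ∨
    Nonempty (G ≃* Equiv.Perm (Fin 4)) ∨
    Nonempty (G ≃* alternatingGroup (Fin 5)) := by
  let ρ : G →* Matrix (Fin 3) (Fin 3) ℝ := (Units.coeHom _).comp G.subtype
  have hρ : Function.Injective ρ := Units.val_injective.comp Subtype.val_injective
  have hρSO (g : G) : (ρ g)ᵀ * ρ g = 1 ∧ (ρ g).det = 1 := hSO g g.2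
  have hρ1 {g : G} (hg : g ≠ 1) : ρ g ≠ 1 := fun h ↦ hg (hρ (h.trans (map_one ρ).symm))
  have hpair {g : G} (hg : g ≠ 1) : ∃ p, p ⬝ᵥ p = 1 ∧ ρ g *ᵥ p = p ∧
      ∀ q, q ⬝ᵥ q = 1 → ρ g *ᵥ q = q → q = p ∨ q = -p := by
    obtain ⟨p, hp, hgp⟩ := exists_unit_fixed (hρSO g).1 (hρSO g).2
    exact ⟨p, hp, hgp, fun q hq hgq ↦
      eq_or_eq_neg_of_fixed (hρSO g).1 (hρSO g).2 (hρ1 hg) hp hq hgp hgq⟩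
  let _ : MulAction G (poles ρ) := polesMulAction ρ fun g ↦ (hρSO g).1
  have hfixed (g : G) (p : poles ρ) : g • p = p ↔ ρ g *ᵥ p.1 = p.1 := Subtype.ext_iff
  have : Finite (poles ρ) := by
    have hsub : poles ρ ⊆ ⋃ g : {g : G // g ≠ 1}, {q | q ⬝ᵥ q = 1 ∧ ρ g *ᵥ q = q} := by
      rintro q ⟨hq, g, hg, hgq⟩
      exact Set.mem_iUnion.2 ⟨⟨g, hg⟩, hq, hgq⟩
    refine (Set.finite_iUnion fun g ↦ ?_).subset hsub
    obtain ⟨p, -, -, h⟩ := hpair g.2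
    exact (Set.toFinite {p, -p}).subset fun q hq ↦ h q hq.1 hq.2
  refine classification_of_two_fixed_points (X := poles ρ) (fun g hg ↦ ?_) (fun p ↦ ?_) fun p ↦ ?_
  · obtain ⟨p, hp, hgp, h⟩ := hpair hg
    have hgn : ρ g *ᵥ (-p) = -p := by rw [Matrix.mulVec_neg, hgp]
    have hpn : -p ⬝ᵥ -p = 1 := by rw [neg_dotProduct_neg, hp]
    refine Set.ncard_eq_two.2 ⟨⟨p, hp, g, hg, hgp⟩, ⟨-p, hpn, g, hg, hgn⟩, ?_, ?_⟩
    · intro heq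
      have : p = 0 := self_eq_neg.1 (congrArg Subtype.val heq)
      simp [this] at hp
    · ext q
      rw [MulAction.mem_fixedBy, hfixed, Set.mem_insert_iff, Set.mem_singleton_iff,
        Subtype.ext_iff, Subtype.ext_iff]
      refine ⟨h q.1 q.2.1, ?_⟩
      rintro (hq | hq) <;> rw [hq] <;> assumption
  · obtain ⟨-, g, hg, hgp⟩ := p.2
    exact fun h ↦ hg ((Subgroup.eq_bot_iff_forall _).1 h g ((hfixed g p).2 hgp))
  · exact isCyclic_of_common_fixed (ρ.comp (MulAction.stabilizer G p).subtype)
      (hρ.comp Subtype.val_injective) (fun h ↦ hρSO h) p.2.1 fun h ↦ (hfixed h p).1 h.2
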